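/- arXiv:math/0510557 — 3 statements merged into one kernel-verified Lean document; each statement's English description precedes it below -/
import Mathlib

section
/- (Wirtinger multi-time inequality, Theorem 2.) Let u : ℝ^p → ℝ^n be a continuously differentiable function that is multiple periodic with period T = (T^1,…,T^p) and has mean zero over T_0, i.e. ∫_{T_0} u(t) dt = 0. Then ∫_{T_0} |u(t)|^2 dt ≤ ((max_i T^i)^2 / (4π^2)) · ∫_{T_0} |∂u/∂t|^2 dt, where |∂u/∂t|^2 = Σ_{i=1}^n Σ_{α=1}^p (∂u^i/∂t^α)^2. -/
open MeasureTheory Real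

/-- The period parallelepiped `T₀ = [0,T¹] × ⋯ × [0,Tᵖ] ⊆ ℝᵖ`. -/
def periodBox {p : ℕ} (T : Fin p → ℝ) : Set (Fin p → ℝ) :=
  Set.univ.pi fun i => Set.Icc 0 (T i)

/-- `u` is multiple periodic with period `T`. -/
def MultiPeriodic {p : ℕ} {E : Type*} (T : Fin p → ℝ) (u : (Fin p → ℝ) → E) : Prop :=
  ∀ (k : Fin p → ℤ) (t : Fin p → ℝ), u (fun i => t i + (k i : ℝ) * T i) = u t

/-- `max_i T^i`. -/
noncomputable def maxPeriod {p : ℕ} (hp : 0 < p) (T : Fin p → ℝ) : ℝ :=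
  Finset.univ.sup' ⟨⟨0, hp⟩, Finset.mem_univ _⟩ T

section PeriodicFunctions

open Set

theorem integral_periodBox {p : ℕ} {E : Type*} [NormedAddCommGroup E] [NormedSpace ℝ E]
    (T : Fin p → ℝ) (hT : ∀ i, 0 < T i) (g : (Fin p → ℝ) → E) :
    ∫ t in periodBox T, g t = (∏ i, T i) • ∫ s in Icc (0 : Fin p → ℝ) 1, g (T * s) := by
  have hprod : 0 < ∏ i, T i := Finset.prod_pos fun i _ => hT i
  have hdet : (Matrix.diagonal T).det ≠ 0 := by
    rw [Matrix.det_diagonal]; exact hprod.ne'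
  have hmap : (Matrix.toLin' (Matrix.diagonal T) : (Fin p → ℝ) → Fin p → ℝ) = fun s => T * s := by
    ext s i
    simp [Matrix.mulVec_diagonal]
  have hemb : MeasurableEmbedding fun s : Fin p → ℝ => T * s := by
    refine Continuous.measurableEmbedding (by fun_prop) fun a b h => ?_
    ext i
    exact mul_left_cancel₀ (hT i).ne' (congrFun h i)
  have hpre : (fun s : Fin p → ℝ => T * s) ⁻¹' periodBox T = Icc 0 1 := by
    ext s
    simp only [periodBox, mem_preimage, mem_univ_pi, Pi.mul_apply, mem_Icc, Pi.le_def,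
      Pi.zero_apply, Pi.one_apply, ← forall_and]
    refine forall_congr' fun i => and_congr ?_ ?_
    · exact mul_nonneg_iff_of_pos_left (hT i)
    · exact mul_le_iff_le_one_right (hT i)
  conv_lhs => rw [← Real.smul_map_diagonal_volume_pi hdet]
  rw [Measure.restrict_smul, integral_smul_measure, Matrix.det_diagonal, abs_of_pos hprod,
    ENNReal.toReal_ofReal hprod.le, hmap, hemb.setIntegral_map, hpre]

theorem integral_Icc_fderiv_single_eq_zero {p : ℕ} {E : Type*} [NormedAddCommGroup E]
    [NormedSpace ℝ E] {f : (Fin p → ℝ) → E} (hf : ContDiff ℝ 1 f) (α : Fin p)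
    (hper : ∀ x, f (x + Pi.single α 1) = f x) :
    ∫ x in Icc (0 : Fin p → ℝ) 1, fderiv ℝ f x (Pi.single α 1) = 0 := by
  cases p with
  | zero => exact α.elim0
  | succ n =>
    have hcont : Continuous fun x => fderiv ℝ f x (Pi.single α 1) :=
      (hf.continuous_fderiv one_ne_zero).clm_apply continuous_const
    have hsum : ∀ x, ∑ i : Fin (n + 1),
        ((if i = α then fderiv ℝ f x else 0 : (Fin (n + 1) → ℝ) →L[ℝ] E)) (Pi.single i 1)
          = fderiv ℝ f x (Pi.single α 1) := fun x => by
      rw [Finset.sum_eq_single α (fun i _ hi => by simp [hi]) (by simp)]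
      simp
    have key := integral_divergence_of_hasFDerivAt_off_countable' (0 : Fin (n + 1) → ℝ) 1
      zero_le_one (fun i => if i = α then f else 0)
      (fun i x => if i = α then fderiv ℝ f x else 0) ∅ countable_empty
      (fun i => by
        split_ifs
        · exact hf.continuous.continuousOn
        · exact continuousOn_const)
      (fun x _ i => by
        split_ifs
        · exact (hf.differentiable one_ne_zero x).hasFDerivAt
        · exact hasFDerivAt_const 0 x)
      (by
        simp only [hsum]
        exact hcont.continuousOn.integrableOn_compact isCompact_Icc)
    simp only [hsum] at key
    rw [key, Finset.sum_eq_zero]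
    intro i _
    by_cases hi : i = α
    · subst hi
      rw [sub_eq_zero]
      refine integral_congr_ae (.of_forall fun x => ?_)
      have hface : (i.insertNth 1 x : Fin (n + 1) → ℝ) = i.insertNth 0 x + Pi.single i 1 := by
        ext j
        induction j using Fin.succAboveCases i with
        | x => simp
        | p j => simp [Fin.succAbove_ne]
      simp only [if_true, Pi.one_apply, Pi.zero_apply]
      rw [hface, hper]
    · simp [hi]

/-- The character `x ↦ exp (-2πi ∑ kᵢ xᵢ)` of `ℝᵖ`. -/
noncomputable def boxChar {p : ℕ} (k : Fin p → ℤ) (x : Fin p → ℝ) : ℂ :=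
  Complex.exp (-(2 * π * Complex.I) * ∑ i, (k i : ℂ) * (x i : ℂ))

theorem boxChar_eq_mFourier {p : ℕ} (k : Fin p → ℤ) (x : Fin p → ℝ) :
    boxChar k x = UnitAddTorus.mFourier (-k) fun i => (x i : UnitAddCircle) := by
  simp only [boxChar, UnitAddTorus.mFourier, ContinuousMap.coe_mk, Pi.neg_apply,
    fourier_coe_apply, ← Complex.exp_sum, Finset.mul_sum]
  congr 1
  refine Finset.sum_congr rfl fun i _ => ?_
  push_cast
  ring

theorem contDiff_boxChar {p : ℕ} (k : Fin p → ℤ) : ContDiff ℝ 1 (boxChar k) := by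
  unfold boxChar
  have h (i : Fin p) : ContDiff ℝ 1 fun x : Fin p → ℝ => (x i : ℂ) :=
    Complex.ofRealCLM.contDiff.comp (contDiff_apply ℝ ℝ i)
  exact (contDiff_const.mul (ContDiff.sum fun i _ => contDiff_const.mul (h i))).cexp

theorem boxChar_add_single {p : ℕ} (k : Fin p → ℤ) (α : Fin p) (x : Fin p → ℝ) :
    boxChar k (x + Pi.single α 1) = boxChar k x := by
  rw [boxChar_eq_mFourier, boxChar_eq_mFourier]
  congr 1
  ext i
  by_cases h : i = α
  · subst h
    simp
  · simp [h]

theorem fderiv_boxChar_single {p : ℕ} (k : Fin p → ℤ) (α : Fin p) (x : Fin p → ℝ) :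
    fderiv ℝ (boxChar k) x (Pi.single α 1) = -(2 * π * Complex.I * k α) * boxChar k x := by
  have h (i : Fin p) : HasFDerivAt (fun x : Fin p → ℝ => (x i : ℂ))
      (Complex.ofRealCLM.comp (ContinuousLinearMap.proj i)) x :=
    Complex.ofRealCLM.hasFDerivAt.comp x (hasFDerivAt_apply i x)
  have h2 := ((HasFDerivAt.fun_sum (u := Finset.univ)
    fun i _ => (h i).const_mul (k i : ℂ)).const_mul (-(2 * π * Complex.I))).cexp
  have h3 : fderiv ℝ (boxChar k) x = _ := h2.fderiv
  rw [h3]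
  simp [boxChar, Pi.single_apply, apply_ite Complex.ofReal]
  ring

theorem integral_boxChar_mul_fderiv {p : ℕ} {f : (Fin p → ℝ) → ℂ} (hf : ContDiff ℝ 1 f)
    (k : Fin p → ℤ) (α : Fin p) (hper : ∀ x, f (x + Pi.single α 1) = f x) :
    ∫ x in Icc (0 : Fin p → ℝ) 1, boxChar k x * fderiv ℝ f x (Pi.single α 1) =
      2 * π * Complex.I * k α * ∫ x in Icc (0 : Fin p → ℝ) 1, boxChar k x * f x := by
  have hk := contDiff_boxChar k
  have key := integral_Icc_fderiv_single_eq_zero (hk.mul hf) α fun x => by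
    rw [boxChar_add_single, hper]
  have hder : ∀ x, fderiv ℝ (fun x => boxChar k x * f x) x (Pi.single α 1) =
      boxChar k x * fderiv ℝ f x (Pi.single α 1)
        - 2 * π * Complex.I * k α * (boxChar k x * f x) := fun x => by
    rw [fderiv_fun_mul (hk.differentiable one_ne_zero x) (hf.differentiable one_ne_zero x)]
    simp [fderiv_boxChar_single]
    ring
  have hcont : Continuous fun x => fderiv ℝ f x (Pi.single α 1) :=
    (hf.continuous_fderiv one_ne_zero).clm_apply continuous_const
  simp only [hder] at key
  rw [integral_sub, integral_const_mul, sub_eq_zero] at key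
  · exact key
  · exact (hk.continuous.mul hcont).continuousOn.integrableOn_compact isCompact_Icc
  · exact (continuous_const.mul
      (hk.continuous.mul hf.continuous)).continuousOn.integrableOn_compact isCompact_Icc

theorem setOf_forall_mem_Ioc_ae_eq_Icc {p : ℕ} :
    {x : Fin p → ℝ | ∀ i, x i ∈ Ioc ((0 : Fin p → ℝ) i) ((0 : Fin p → ℝ) i + 1)} =ᵐ[volume]
      Icc (0 : Fin p → ℝ) 1 := by
  have := Measure.univ_pi_Ioc_ae_eq_Icc (μ := fun _ : Fin p => (volume : Measure ℝ))
    (f := 0) (g := 1)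
  rw [← volume_pi] at this
  have hset : {x : Fin p → ℝ | ∀ i, x i ∈ Ioc ((0 : Fin p → ℝ) i) ((0 : Fin p → ℝ) i + 1)} =
      univ.pi fun i => Ioc ((0 : Fin p → ℝ) i) ((1 : Fin p → ℝ) i) := by
    ext x
    simp
  rwa [hset]

noncomputable local instance : MeasureSpace UnitAddCircle := ⟨AddCircle.haarAddCircle⟩

local instance : Measure.IsAddHaarMeasure (volume : Measure UnitAddCircle) :=
  inferInstanceAs (Measure.IsAddHaarMeasure AddCircle.haarAddCircle)

local instance : IsProbabilityMeasure (volume : Measure UnitAddCircle) :=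
  inferInstanceAs (IsProbabilityMeasure AddCircle.haarAddCircle)

/-- Parseval's identity on the unit cube. -/
theorem hasSum_sq_integral_boxChar_mul {p : ℕ} {f : (Fin p → ℝ) → ℂ} (hf : Continuous f) :
    HasSum (fun k : Fin p → ℤ => ‖∫ x in Icc (0 : Fin p → ℝ) 1, boxChar k x * f x‖ ^ 2)
      (∫ x in Icc (0 : Fin p → ℝ) 1, ‖f x‖ ^ 2) := by
  set F : UnitAddTorus (Fin p) → ℂ :=
    fun y => f (UnitAddTorus.measurableEquivPiIoc (0 : Fin p → ℝ) y).1 with hF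
  have hFx : ∀ x ∈ {x : Fin p → ℝ | ∀ i, x i ∈ Ioc ((0 : Fin p → ℝ) i) ((0 : Fin p → ℝ) i + 1)},
      F (fun i => (x i : UnitAddCircle)) = f x := fun x hx => by
    have := (UnitAddTorus.measurableEquivPiIoc (0 : Fin p → ℝ)).apply_symm_apply ⟨x, hx⟩
    rw [UnitAddTorus.coe_symm_measurableEquivPiIoc_apply] at this
    rw [hF]
    simp only [this]
  have hmeasC : MeasurableSet
      {x : Fin p → ℝ | ∀ i, x i ∈ Ioc ((0 : Fin p → ℝ) i) ((0 : Fin p → ℝ) i + 1)} :=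
    MeasurableSet.univ_pi' fun i => measurableSet_Ioc
  have hFmeas : Measurable F := hf.measurable.comp
    (measurable_subtype_coe.comp (UnitAddTorus.measurableEquivPiIoc 0).measurable)
  obtain ⟨C, hC⟩ := (isCompact_Icc (a := (0 : Fin p → ℝ)) (b := 1)).exists_bound_of_continuousOn
    hf.continuousOn
  have hFmem : MemLp F 2 volume := by
    refine MemLp.of_bound hFmeas.aestronglyMeasurable C (.of_forall fun y => hC _ ?_)
    have := (UnitAddTorus.measurableEquivPiIoc (0 : Fin p → ℝ) y).2
    simp only [Pi.zero_apply, zero_add, mem_Ioc] at this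
    exact ⟨fun i => (this i).1.le, fun i => (this i).2⟩
  have key := UnitAddTorus.hasSum_sq_mFourierCoeff hFmem.toLp
  have h1 : ∫ t, ‖hFmem.toLp F t‖ ^ 2 = ∫ x in Icc (0 : Fin p → ℝ) 1, ‖f x‖ ^ 2 := by
    rw [← setIntegral_congr_set setOf_forall_mem_Ioc_ae_eq_Icc]
    trans ∫ t, ‖F t‖ ^ 2
    · refine integral_congr_ae ?_
      filter_upwards [hFmem.coeFn_toLp] with t ht
      rw [ht]
    · rw [UnitAddTorus.integral_preimage _ 0]
      exact setIntegral_congr_fun hmeasC fun x hx => by simp only [hFx x hx]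
  have h2 : ∀ k, UnitAddTorus.mFourierCoeff (hFmem.toLp F) k =
      ∫ x in Icc (0 : Fin p → ℝ) 1, boxChar k x * f x := fun k => by
    rw [← setIntegral_congr_set setOf_forall_mem_Ioc_ae_eq_Icc]
    trans UnitAddTorus.mFourierCoeff F k
    · refine integral_congr_ae ?_
      filter_upwards [hFmem.coeFn_toLp] with t ht
      rw [ht]
    · rw [UnitAddTorus.mFourierCoeff_eq_integral F k 0]
      exact setIntegral_congr_fun hmeasC fun x hx => by
        simp only [hFx x hx, boxChar_eq_mFourier, smul_eq_mul]
  simpa only [h1, h2] using key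

/-- Wirtinger's inequality on the unit cube for complex-valued functions. -/
theorem wirtinger_Icc_zero_one {p : ℕ} {f : (Fin p → ℝ) → ℂ} (hf : ContDiff ℝ 1 f)
    (hper : ∀ α x, f (x + Pi.single α 1) = f x)
    (hmean : ∫ x in Icc (0 : Fin p → ℝ) 1, f x = 0) :
    4 * π ^ 2 * ∫ x in Icc (0 : Fin p → ℝ) 1, ‖f x‖ ^ 2 ≤
      ∑ α, ∫ x in Icc (0 : Fin p → ℝ) 1, ‖fderiv ℝ f x (Pi.single α 1)‖ ^ 2 := by
  have hcont (α : Fin p) : Continuous fun x => fderiv ℝ f x (Pi.single α 1) :=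
    (hf.continuous_fderiv one_ne_zero).clm_apply continuous_const
  refine hasSum_le (fun k => ?_) ((hasSum_sq_integral_boxChar_mul hf.continuous).mul_left _)
    (hasSum_sum fun α _ => hasSum_sq_integral_boxChar_mul (hcont α))
  simp only [integral_boxChar_mul_fderiv hf k _ (hper _)]
  rcases eq_or_ne k 0 with rfl | hk
  · simp [boxChar, hmean]
  obtain ⟨β, hβ⟩ := Function.ne_iff.mp hk
  have hnorm (α : Fin p) : ‖2 * π * Complex.I * k α *
      ∫ x in Icc (0 : Fin p → ℝ) 1, boxChar k x * f x‖ ^ 2 =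
      (k α : ℝ) ^ 2 *
        (4 * π ^ 2 * ‖∫ x in Icc (0 : Fin p → ℝ) 1, boxChar k x * f x‖ ^ 2) := by
    simp only [norm_mul, Complex.norm_I, Complex.norm_real, Complex.norm_intCast, mul_pow,
      Complex.norm_ofNat, Real.norm_eq_abs, sq_abs]
    ring
  simp only [hnorm]
  refine le_trans ?_ (Finset.single_le_sum (fun α _ => by positivity) (Finset.mem_univ β))
  refine le_mul_of_one_le_left (by positivity) ?_
  exact_mod_cast (one_le_sq_iff_one_le_abs _).mpr (Int.one_le_abs hβ)

end PeriodicFunctions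

/-- Wirtinger multi-time inequality, Theorem 2: a `C¹` multiply periodic
function `u : ℝᵖ → ℝⁿ` with mean zero over the period box satisfies
`∫ |u|² ≤ ((max_i Tⁱ)²/(4π²)) ∫ |∂u/∂t|²`. -/
theorem wirtinger_multitime
    (p n : ℕ) (hp : 0 < p) (hn : 0 < n)
    (T : Fin p → ℝ) (hT : ∀ i, 0 < T i)
    (u : (Fin p → ℝ) → (Fin n → ℝ))
    (hu : ContDiff ℝ 1 u)
    (hper : MultiPeriodic T u)
    (hmean : (∫ t in periodBox T, u t) = 0) :
    (∫ t in periodBox T, ∑ i, (u t i) ^ 2)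
      ≤ ((maxPeriod hp T) ^ 2 / (4 * π ^ 2)) *
        ∫ t in periodBox T, ∑ i, ∑ α, (fderiv ℝ u t (Pi.single α 1) i) ^ 2 := by
  have hprod : 0 < ∏ i, T i := Finset.prod_pos fun i _ => hT i
  have hint {E : Type} [NormedAddCommGroup E] {g : (Fin p → ℝ) → E} (hg : Continuous g) :
      IntegrableOn g (Set.Icc 0 1) := hg.continuousOn.integrableOn_compact isCompact_Icc
  have hTc : Continuous fun s : Fin p → ℝ => T * s := by fun_prop
  have huc (i : Fin n) : Continuous fun s => u (T * s) i :=
    (continuous_apply i).comp (hu.continuous.comp hTc)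
  have hdc (i : Fin n) (α : Fin p) :
      Continuous fun s => fderiv ℝ u (T * s) (Pi.single α 1) i :=
    (continuous_apply i).comp
      (((hu.continuous_fderiv one_ne_zero).comp hTc).clm_apply continuous_const)
  have hM (α : Fin p) : (T α) ^ 2 ≤ maxPeriod hp T ^ 2 :=
    pow_le_pow_left₀ (hT α).le (Finset.le_sup' T (Finset.mem_univ α)) 2
  rw [integral_periodBox T hT] at hmean ⊢
  rw [integral_periodBox T hT]
  have hmean0 := (smul_eq_zero.mp hmean).resolve_left hprod.ne'
  have hcomp (i : Fin n) : 4 * π ^ 2 * ∫ s in Set.Icc (0 : Fin p → ℝ) 1, (u (T * s) i) ^ 2 ≤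
      maxPeriod hp T ^ 2 * ∑ α, ∫ s in Set.Icc (0 : Fin p → ℝ) 1,
        (fderiv ℝ u (T * s) (Pi.single α 1) i) ^ 2 := by
    have hfd (s : Fin p → ℝ) : HasFDerivAt (fun s => ((u (T * s) i : ℝ) : ℂ))
        (Complex.ofRealCLM.comp ((ContinuousLinearMap.proj i).comp
          ((fderiv ℝ u (T * s)).comp (ContinuousLinearMap.mul ℝ (Fin p → ℝ) T)))) s := by
      have h := (hu.differentiable one_ne_zero (T * s)).hasFDerivAt.comp s
        (ContinuousLinearMap.mul ℝ (Fin p → ℝ) T).hasFDerivAt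
      exact Complex.ofRealCLM.hasFDerivAt.comp s (hasFDerivAt_pi'.mp h i)
    have hsingle (α : Fin p) : T * Pi.single α 1 = T α • (Pi.single α 1 : Fin p → ℝ) := by
      ext j
      by_cases h : j = α
      · subst h; simp
      · simp [h]
    have hw := wirtinger_Icc_zero_one (f := fun s => ((u (T * s) i : ℝ) : ℂ))
      (Complex.ofRealCLM.contDiff.comp ((contDiff_apply ℝ ℝ i).comp
        (hu.comp (ContinuousLinearMap.mul ℝ (Fin p → ℝ) T).contDiff)))
      (fun α s => by
        have := hper (Pi.single α 1) (T * s)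
        rw [← this]
        congr 3
        ext j
        by_cases h : j = α
        · subst h; simp; ring
        · simp [h])
      (by
        rw [integral_complex_ofReal, ← eval_integral fun j => hint (huc j), hmean0]
        simp)
    simp only [(hfd _).fderiv, ContinuousLinearMap.comp_apply, ContinuousLinearMap.mul_apply',
      hsingle, map_smul, Complex.norm_real, Complex.ofRealCLM_apply, Real.norm_eq_abs, sq_abs,
      ContinuousLinearMap.proj_apply, smul_eq_mul, mul_pow,
      integral_const_mul] at hw
    refine hw.trans ?_
    rw [Finset.mul_sum]
    exact Finset.sum_le_sum fun α _ => mul_le_mul_of_nonneg_right (hM α)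
      (integral_nonneg fun s => sq_nonneg _)
  rw [integral_finsetSum _ fun i _ => hint ((huc i).fun_pow 2),
    integral_finsetSum _ fun i _ => hint (by fun_prop)]
  simp only [integral_finsetSum _ fun α _ => hint ((hdc _ α).fun_pow 2)]
  rw [smul_eq_mul, smul_eq_mul, mul_left_comm]
  refine mul_le_mul_of_nonneg_left ?_ hprod.le
  rw [div_mul_eq_mul_div, le_div_iff₀' (by positivity), Finset.mul_sum, Finset.mul_sum]
  exact Finset.sum_le_sum fun i _ => hcomp i
end

section
/- (Theorem 3.) Let u = (x, q) where x : ℝ^p → ℝ^n and q = (q_i^α) : ℝ^p → ℝ^{np} are continuously differentiable and multiple periodic with period T = (T^1,…,T^p). Then ∫_{T_0} ⟨(δ⊗J) ∂u/∂t, u(t)⟩ dt ≥ −(√p · max_i T^i / (2π)) · ∫_{T_0} |∂u/∂t|^2 dt, where ⟨(δ⊗J) ∂u/∂t, u⟩ = Σ_{i=1}^n (Σ_{α=1}^p ∂q_i^α/∂t^α) x^i − Σ_{i=1}^n Σ_{β=1}^p (∂x^i/∂t^β) q_i^β. -/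
open MeasureTheory Real

/-- **Wirtinger's inequality** for a mean-zero `C¹` function with equal boundary values. -/
theorem wirtinger_inequality {T : ℝ} (hT : 0 < T) {f f' : ℝ → ℝ}
    (hf : ∀ s, HasDerivAt f (f' s) s) (hf' : Continuous f')
    (hper : f T = f 0) (hmean : ∫ s in 0..T, f s = 0) :
    ∫ s in 0..T, f s ^ 2 ≤ (T / (2 * π)) ^ 2 * ∫ s in 0..T, f' s ^ 2 := by
  have hfc : Continuous f := continuous_iff_continuousAt.2 fun s => (hf s).continuousAt
  have parseval : ∀ g : ℝ → ℝ, Continuous g →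
      HasSum (fun k => ‖fourierCoeffOn hT (fun s => (g s : ℂ)) k‖ ^ 2)
        (T⁻¹ * ∫ s in 0..T, g s ^ 2) := by
    intro g hg
    have hmem : MemLp (fun s => (g s : ℂ)) 2 (volume.restrict (Set.Ioc 0 T)) :=
      (memLp_two_iff_integrable_sq_norm
        (Complex.continuous_ofReal.comp hg).aestronglyMeasurable).2
        ((by fun_prop : Continuous fun s => ‖(g s : ℂ)‖ ^ 2).integrableOn_Ioc)
    simpa using hasSum_sq_fourierCoeffOn hT hmem
  have hle : T⁻¹ * ∫ s in 0..T, f s ^ 2 ≤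
      (T / (2 * π)) ^ 2 * (T⁻¹ * ∫ s in 0..T, f' s ^ 2) := by
    refine hasSum_le (fun k => ?_) (parseval f hfc) ((parseval f' hf').mul_left _)
    by_cases hk : k = 0
    · subst hk
      have h0 : fourierCoeffOn hT (fun s => (f s : ℂ)) 0 = 0 := by
        rw [fourierCoeffOn_eq_integral]
        simp [intervalIntegral.integral_ofReal, hmean]
      rw [h0]
      rw [norm_zero, zero_pow two_ne_zero]
      positivity
    · have hcoeff := fourierCoeffOn_of_hasDerivAt hT hk
        (f := fun s => (f s : ℂ)) (f' := fun s => (f' s : ℂ))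
        (fun s _ => (hf s).ofReal_comp)
        ((Complex.continuous_ofReal.comp hf').intervalIntegrable _ _)
      have hk1 : (1 : ℝ) ≤ |(k : ℝ)| := by exact_mod_cast Int.one_le_abs hk
      rw [hcoeff, ← mul_pow]
      refine pow_le_pow_left₀ (norm_nonneg _) ?_ 2
      simp only [hper, sub_self, mul_zero, zero_sub, norm_mul, norm_div, norm_neg, norm_one,
        Complex.norm_real, Complex.norm_I, Complex.norm_intCast, Complex.norm_ofNat,
        Complex.ofReal_zero, sub_zero, Real.norm_eq_abs, abs_of_pos hT, abs_of_pos pi_pos,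
        mul_one, ← mul_assoc]
      refine mul_le_mul_of_nonneg_right ?_ (norm_nonneg _)
      rw [one_div_mul_eq_div]
      exact div_le_div_of_nonneg_left hT.le (by positivity)
        (le_mul_of_one_le_right (by positivity) hk1)
  have hTi : 0 < T⁻¹ := inv_pos.2 hT
  refine le_of_mul_le_mul_left ?_ hTi
  linarith

/-- The isoperimetric inequality for the signed area of a closed `C¹` plane curve. -/
theorem integral_area_add_energy_nonneg {T C : ℝ} (hT : 0 < T) (hC : T / (2 * π) ≤ C)
    {f f' g g' : ℝ → ℝ}
    (hf : ∀ s, HasDerivAt f (f' s) s) (hf' : Continuous f')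
    (hg : ∀ s, HasDerivAt g (g' s) s) (hg' : Continuous g')
    (hfper : f T = f 0) (hgper : g T = g 0) :
    0 ≤ ∫ s in 0..T, (g' s * f s - f' s * g s + C * (f' s ^ 2 + g' s ^ 2)) := by
  have hfc : Continuous f := continuous_iff_continuousAt.2 fun s => (hf s).continuousAt
  have hgc : Continuous g := continuous_iff_continuousAt.2 fun s => (hg s).continuousAt
  set c := T / (2 * π)
  have hc0 : 0 < c := by positivity
  set m := T⁻¹ * ∫ s in 0..T, f s with hm
  have hmean : ∫ s in 0..T, (f s - m) = 0 := by
    rw [intervalIntegral.integral_sub (hfc.intervalIntegrable _ _) (by simp)]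
    simp [hm, hT.ne']
  have hw := wirtinger_inequality hT (fun s => (hf s).sub_const m) hf'
    (by rw [hfper]) hmean
  have hD : ∫ s in 0..T, (f' s * g s + (f s - m) * g' s - m * g' s) = 0 := by
    rw [intervalIntegral.integral_eq_sub_of_hasDerivAt
      (f := fun s => (f s - m) * g s - m * g s)
      (fun s _ => (((hf s).sub_const m).mul (hg s)).sub ((hg s).const_mul m))
      ((by fun_prop : Continuous _).intervalIntegrable _ _), hfper, hgper, sub_self]
  have hI1 : IntervalIntegrable (fun s => f' s * g s + (f s - m) * g' s - m * g' s)
      volume 0 T := (by fun_prop : Continuous _).intervalIntegrable _ _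
  have hI2 : IntervalIntegrable (fun s => c * f' s ^ 2) volume 0 T :=
    (by fun_prop : Continuous _).intervalIntegrable _ _
  have hI3 : IntervalIntegrable (fun s => c⁻¹ * (f s - m) ^ 2) volume 0 T :=
    (by fun_prop : Continuous _).intervalIntegrable _ _
  have hlow : 0 ≤ ∫ s in 0..T, (c * f' s ^ 2 - c⁻¹ * (f s - m) ^ 2
      - (f' s * g s + (f s - m) * g' s - m * g' s)) := by
    rw [intervalIntegral.integral_sub (hI2.sub hI3) hI1,
      intervalIntegral.integral_sub hI2 hI3, hD, intervalIntegral.integral_const_mul,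
      intervalIntegral.integral_const_mul]
    have := mul_le_mul_of_nonneg_left hw (inv_pos.2 hc0).le
    have e : c⁻¹ * (c ^ 2 * ∫ s in 0..T, f' s ^ 2) = c * ∫ s in 0..T, f' s ^ 2 := by
      field_simp
    linarith
  refine hlow.trans (intervalIntegral.integral_mono_on hT.le ((hI2.sub hI3).sub hI1)
    ((by fun_prop : Continuous _).intervalIntegrable _ _) fun s _ => ?_)
  have hsq : 0 ≤ c⁻¹ * ((f s - m) + c * g' s) ^ 2 := by positivity
  have e : c⁻¹ * ((f s - m) + c * g' s) ^ 2
      = c⁻¹ * (f s - m) ^ 2 + 2 * (f s - m) * g' s + c * g' s ^ 2 := by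
    field_simp
    ring
  have hCc := mul_le_mul_of_nonneg_right hC (by positivity : 0 ≤ f' s ^ 2 + g' s ^ 2)
  nlinarith

theorem integrableOn_periodBox {p : ℕ} (T : Fin p → ℝ) {h : (Fin p → ℝ) → ℝ}
    (hh : Continuous h) : IntegrableOn h (periodBox T) :=
  hh.continuousOn.integrableOn_compact (isCompact_univ_pi fun _ => isCompact_Icc)

/-- A continuous function whose integrals along all lines in direction `α` are nonnegative
has nonnegative integral over the period box. -/
theorem integral_periodBox_nonneg {p : ℕ} {T : Fin p → ℝ} (hT : ∀ i, 0 < T i) (α : Fin p)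
    {h : (Fin p → ℝ) → ℝ} (hh : Continuous h)
    (hline : ∀ t : Fin p → ℝ, 0 ≤ ∫ s in 0..T α, h (Function.update t α s)) :
    0 ≤ ∫ t in periodBox T, h t := by
  obtain _ | m := p
  · exact α.elim0
  have hint : IntegrableOn h (periodBox T) := integrableOn_periodBox T hh
  have hrestr : (volume : Measure (Fin (m + 1) → ℝ)).restrict (periodBox T)
      = Measure.pi fun i => volume.restrict (Set.Icc 0 (T i)) := by
    rw [volume_pi, periodBox, Measure.restrict_pi_pi]
  rw [IntegrableOn, hrestr] at hint
  have hmp := (measurePreserving_piFinSuccAbove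
    (fun i : Fin (m + 1) => (volume : Measure ℝ).restrict (Set.Icc 0 (T i))) α).symm
  rw [hrestr, ← hmp.integral_comp', integral_prod_symm]
  · refine integral_nonneg fun y => ?_
    have := hline (α.insertNth 0 y)
    rw [intervalIntegral.integral_of_le (hT α).le, ← integral_Icc_eq_integral_Ioc] at this
    simp only [Fin.update_insertNth] at this
    exact this
  · exact (hmp.integrable_comp_emb (MeasurableEquiv.measurableEmbedding _)).2 hint

theorem MultiPeriodic.update_period {p : ℕ} {E : Type*} {T : Fin p → ℝ}
    {u : (Fin p → ℝ) → E} (hu : MultiPeriodic T u) (t : Fin p → ℝ) (α : Fin p) :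
    u (Function.update t α (T α)) = u (Function.update t α 0) := by
  rw [← hu (Pi.single α 1) (Function.update t α 0)]
  congr 1
  ext j
  by_cases hj : j = α
  · subst hj
    simp
  · simp [hj]

theorem le_maxPeriod {p : ℕ} (hp : 0 < p) (T : Fin p → ℝ) (α : Fin p) :
    T α ≤ maxPeriod hp T :=
  Finset.le_sup' T (Finset.mem_univ α)

/-- Theorem 3: for `u = (x,q)` `C¹` and multiply periodic,
`∫ ⟨(δ⊗J) ∂u/∂t, u⟩ ≥ −(√p · max_i Tⁱ/(2π)) ∫ |∂u/∂t|²`, where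
`⟨(δ⊗J) ∂u/∂t, u⟩ = Σ_i (Σ_α ∂q_i^α/∂t^α) x^i − Σ_{i,β} (∂x^i/∂t^β) q_i^β`. -/
theorem polysymplectic_integral_lower_bound
    (p n : ℕ) (hp : 0 < p) (hn : 0 < n)
    (T : Fin p → ℝ) (hT : ∀ i, 0 < T i)
    (x : (Fin p → ℝ) → (Fin n → ℝ)) (q : (Fin p → ℝ) → (Fin n → Fin p → ℝ))
    (hx : ContDiff ℝ 1 x) (hq : ContDiff ℝ 1 q)
    (hxper : MultiPeriodic T x) (hqper : MultiPeriodic T q) :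
    (∫ t in periodBox T,
        ((∑ i, (∑ α, fderiv ℝ q t (Pi.single α 1) i α) * x t i)
          - ∑ i, ∑ β, (fderiv ℝ x t (Pi.single β 1) i) * q t i β))
      ≥ -(Real.sqrt p * maxPeriod hp T / (2 * π)) *
        ∫ t in periodBox T,
          ((∑ i, ∑ α, (fderiv ℝ x t (Pi.single α 1) i) ^ 2)
            + ∑ i, ∑ α, ∑ β, (fderiv ℝ q t (Pi.single β 1) i α) ^ 2) := by
  set C := Real.sqrt p * maxPeriod hp T / (2 * π)
  have hmax : 0 < maxPeriod hp T := (hT ⟨0, hp⟩).trans_le (le_maxPeriod hp T _)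
  have hC0 : 0 ≤ C := by positivity
  have hC : ∀ α, T α / (2 * π) ≤ C := fun α => by
    have hs : 1 ≤ Real.sqrt p := Real.one_le_sqrt.2 (by exact_mod_cast hp)
    refine div_le_div_of_nonneg_right ?_ (by positivity)
    exact (le_maxPeriod hp T α).trans (le_mul_of_one_le_left hmax.le hs)
  have hxc : Continuous x := hx.continuous
  have hqc : Continuous q := hq.continuous
  have hdx : ∀ v i, Continuous fun t => fderiv ℝ x t v i := fun v i =>
    (continuous_apply i).comp ((hx.continuous_fderiv one_ne_zero).clm_apply continuous_const)
  have hdq : ∀ v i α, Continuous fun t => fderiv ℝ q t v i α := fun v i α =>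
    (continuous_apply_apply i α).comp
      ((hq.continuous_fderiv one_ne_zero).clm_apply continuous_const)
  let h : Fin n → Fin p → (Fin p → ℝ) → ℝ := fun i α t =>
    fderiv ℝ q t (Pi.single α 1) i α * x t i - fderiv ℝ x t (Pi.single α 1) i * q t i α
      + C * (fderiv ℝ x t (Pi.single α 1) i ^ 2 + fderiv ℝ q t (Pi.single α 1) i α ^ 2)
  have hhc : ∀ i α, Continuous (h i α) := fun i α => by
    have h1 := hdx (Pi.single α 1) i
    have h2 := hdq (Pi.single α 1) i α
    fun_prop
  have hnonneg : ∀ i α, 0 ≤ ∫ t in periodBox T, h i α t := fun i α => by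
    refine integral_periodBox_nonneg hT α (hhc i α) fun t => ?_
    have hup : Continuous fun s => Function.update t α s :=
      continuous_const.update α continuous_id
    refine integral_area_add_energy_nonneg (hT α) (hC α)
      (f := fun s => x (Function.update t α s) i) (g := fun s => q (Function.update t α s) i α)
      (fun s => ?_) ((hdx _ i).comp hup) (fun s => ?_) ((hdq _ i α).comp hup)
      (by rw [hxper.update_period]) (by rw [hqper.update_period])
    · exact hasDerivAt_pi.1 (((hx.differentiable one_ne_zero _).hasFDerivAt).comp_hasDerivAt s
        (hasDerivAt_update t α s)) i
    · exact hasDerivAt_pi.1 (hasDerivAt_pi.1 (((hq.differentiable one_ne_zero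
        _).hasFDerivAt).comp_hasDerivAt s (hasDerivAt_update t α s)) i) α
  have hA : Continuous fun t => (∑ i, (∑ α, fderiv ℝ q t (Pi.single α 1) i α) * x t i)
      - ∑ i, ∑ β, (fderiv ℝ x t (Pi.single β 1) i) * q t i β := by
    fun_prop
  have hB : Continuous fun t => (∑ i, ∑ α, (fderiv ℝ x t (Pi.single α 1) i) ^ 2)
      + ∑ i, ∑ α, ∑ β, (fderiv ℝ q t (Pi.single β 1) i α) ^ 2 := by
    fun_prop
  have hsum : 0 ≤ ∫ t in periodBox T, ∑ i, ∑ α, h i α t := by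
    rw [integral_finsetSum _ fun i _ => integrableOn_periodBox T (by fun_prop)]
    refine Finset.sum_nonneg fun i _ => ?_
    rw [integral_finsetSum _ fun α _ => integrableOn_periodBox T (hhc i α)]
    exact Finset.sum_nonneg fun α _ => hnonneg i α
  have hmono := hsum.trans (integral_mono (integrableOn_periodBox T (by fun_prop))
    ((integrableOn_periodBox T hA).add ((integrableOn_periodBox T hB).const_mul C)) fun t => ?_)
  · simp only [Pi.add_apply] at hmono
    rw [integral_add (integrableOn_periodBox T hA) ((integrableOn_periodBox T hB).const_mul C),
      integral_const_mul] at hmono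
    linarith
  · have hdiag : ∑ i, ∑ α, fderiv ℝ q t (Pi.single α 1) i α ^ 2
        ≤ ∑ i, ∑ α, ∑ β, (fderiv ℝ q t (Pi.single β 1) i α) ^ 2 :=
      Finset.sum_le_sum fun i _ => Finset.sum_le_sum fun α _ =>
        Finset.single_le_sum (f := fun β => fderiv ℝ q t (Pi.single β 1) i α ^ 2)
          (fun β _ => sq_nonneg _) (Finset.mem_univ α)
    have hdiagC := mul_le_mul_of_nonneg_left hdiag hC0
    simp only [h, Pi.add_apply, Finset.sum_add_distrib, Finset.sum_sub_distrib, Finset.sum_mul,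
      mul_add, ← Finset.mul_sum]
    linarith
end

section
/- (Theorem 4, inequality (5).) Let H : ℝ^p × ℝ^{n+np} → ℝ, (t,u) ↦ H(t,u), be measurable in t for each u and continuously differentiable and convex in u for each t ∈ T_0. Suppose there exist constants α ∈ (0, π/(√p · max_i T^i)), β ≥ 0, γ ≥ 0, δ > 0 such that δ|u| − β ≤ H(t,u) ≤ (α/2)|u|^2 + γ for all t ∈ T_0 and all u ∈ ℝ^{n+np}. Then every continuously differentiable, multiple periodic (with period T) solution u = (x, q) of the multi-time Hamilton system (δ⊗J) ∂u/∂t + ∇_u H(t, u(t)) = 0 on T_0 satisfies ∫_{T_0} |u(t)| dt ≤ π(β+γ) T^1⋯T^p / (δ(π − α √p · max_i T^i)). -/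
open MeasureTheory Real

/-- The Euclidean norm of `w = (x,q) ∈ ℝ^{n+np}`. -/
noncomputable def euclNorm {p n : ℕ} (w : (Fin n → ℝ) × (Fin n → Fin p → ℝ)) : ℝ :=
  Real.sqrt ((∑ i, (w.1 i) ^ 2) + ∑ i, ∑ α, (w.2 i α) ^ 2)

/-- `u = (x,q)` solves the multi-time Hamilton system
`(δ⊗J) ∂u/∂t + ∇_u H(t,u(t)) = 0` at every `t` of the period box, i.e.
`Σ_α ∂q_i^α/∂t^α = −∂H/∂x^i` and `∂x^i/∂t^β = ∂H/∂q_i^β`. -/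
def IsHamiltonSolution {p n : ℕ} (T : Fin p → ℝ)
    (H : (Fin p → ℝ) → (Fin n → ℝ) × (Fin n → Fin p → ℝ) → ℝ)
    (x : (Fin p → ℝ) → (Fin n → ℝ)) (q : (Fin p → ℝ) → (Fin n → Fin p → ℝ)) : Prop :=
  ∀ t ∈ periodBox T,
    (∀ i, (∑ α, fderiv ℝ q t (Pi.single α 1) i α)
        = - fderiv ℝ (H t) (x t, q t) ((Pi.single i 1 : Fin n → ℝ), 0)) ∧
    (∀ i β, fderiv ℝ x t (Pi.single β 1) i
        = fderiv ℝ (H t) (x t, q t) ((0 : Fin n → ℝ), Pi.single i (Pi.single β 1)))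

/-- The character `t ↦ exp (2πi k·t)` of `ℝᵖ`. -/
noncomputable def latticeChar {p : ℕ} (k : Fin p → ℤ) (t : Fin p → ℝ) : ℂ :=
  Complex.exp (2 * π * Complex.I * ∑ i, (k i : ℂ) * (t i : ℂ))

lemma mFourier_coe_eq_latticeChar {p : ℕ} (k : Fin p → ℤ) (t : Fin p → ℝ) :
    UnitAddTorus.mFourier k (fun i => (t i : UnitAddCircle)) = latticeChar k t := by
  simp only [UnitAddTorus.mFourier, ContinuousMap.coe_mk, fourier_coe_apply, latticeChar,
    ← Complex.exp_sum, Finset.mul_sum]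
  congr 1
  refine Finset.sum_congr rfl fun i _ => ?_
  simp; ring

/-- A continuous `ℤᵖ`-periodic function descends to the torus. -/
lemma exists_continuousMap_unitAddTorus {p : ℕ} (g : (Fin p → ℝ) → ℂ) (hg : Continuous g)
    (hper : ∀ (k : Fin p → ℤ) t, g (fun i => t i + k i) = g t) :
    ∃ F : C(UnitAddTorus (Fin p), ℂ), ∀ t : Fin p → ℝ,
      F (fun i => (t i : UnitAddCircle)) = g t := by
  have hq : IsOpenQuotientMap
      (fun t : Fin p → ℝ => (fun i => (t i : UnitAddCircle) : UnitAddTorus (Fin p))) :=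
    IsOpenQuotientMap.piMap fun _ => QuotientAddGroup.isOpenQuotientMap_mk
  have hsurj := hq.surjective
  choose r hr using hsurj
  have key : ∀ t : Fin p → ℝ, g (r (fun i => (t i : UnitAddCircle))) = g t := by
    intro t
    have h : ∀ i, ∃ k : ℤ, r (fun i => (t i : UnitAddCircle)) i = t i + k := by
      intro i
      have := congrFun (hr (fun i => (t i : UnitAddCircle))) i
      obtain ⟨k, hk⟩ := AddSubgroup.mem_zmultiples_iff.1 (QuotientAddGroup.eq.1 this.symm)
      refine ⟨k, ?_⟩
      rw [zsmul_one] at hk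
      linarith
    choose k hk using h
    rw [← hper k t]
    exact congrArg g (funext hk)
  refine ⟨⟨fun z => g (r z), ?_⟩, key⟩
  rw [hq.isQuotientMap.continuous_iff]
  convert hg using 1
  exact funext key

/-- **Parseval's identity** for continuous `ℤᵖ`-periodic functions. -/
lemma hasSum_sq_norm_integral_latticeChar {p : ℕ} (g : (Fin p → ℝ) → ℂ) (hg : Continuous g)
    (hper : ∀ (k : Fin p → ℤ) t, g (fun i => t i + k i) = g t) :
    HasSum (fun k : Fin p → ℤ => ‖∫ t in Set.Icc (0 : Fin p → ℝ) 1, latticeChar (-k) t * g t‖ ^ 2)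
      (∫ t in Set.Icc (0 : Fin p → ℝ) 1, ‖g t‖ ^ 2) := by
  obtain ⟨F, hF⟩ := exists_continuousMap_unitAddTorus g hg hper
  have hbox : ({x : Fin p → ℝ | ∀ i, x i ∈ Set.Ioc ((0 : Fin p → ℝ) i) ((0 : Fin p → ℝ) i + 1)})
      =ᵐ[volume] Set.Icc (0 : Fin p → ℝ) 1 := by
    have := Measure.univ_pi_Ioc_ae_eq_Icc (μ := fun _ : Fin p => (volume : Measure ℝ))
      (f := 0) (g := 1)
    rw [← volume_pi] at this
    have hset : {x : Fin p → ℝ | ∀ i, x i ∈ Set.Ioc ((0 : Fin p → ℝ) i) ((0 : Fin p → ℝ) i + 1)}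
        = Set.univ.pi fun i => Set.Ioc ((0 : Fin p → ℝ) i) ((1 : Fin p → ℝ) i) := by
      ext x; simp [Set.mem_pi]
    rw [hset]
    exact this
  let _ : MeasureSpace UnitAddCircle := ⟨AddCircle.haarAddCircle⟩
  have : IsProbabilityMeasure (volume : Measure UnitAddCircle) :=
    inferInstanceAs (IsProbabilityMeasure AddCircle.haarAddCircle)
  have hP := UnitAddTorus.hasSum_sq_mFourierCoeff (ContinuousMap.toLp 2 volume ℂ F)
  have hint := fun f : UnitAddTorus (Fin p) → ℝ => UnitAddTorus.integral_preimage f 0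
  convert! hP using 1
  · ext k
    rw [UnitAddTorus.mFourierCoeff_toLp, UnitAddTorus.mFourierCoeff_eq_integral _ _ 0,
      setIntegral_congr_set hbox]
    simp only [mFourier_coe_eq_latticeChar, hF, smul_eq_mul]
  · rw [← setIntegral_congr_set hbox]
    simp only [← hF]
    rw [← hint (fun z => ‖F z‖ ^ 2)]
    refine (integral_congr_ae ?_)
    filter_upwards [ContinuousMap.coeFn_toLp (p := 2) (𝕜 := ℂ) volume F] with z hz
    rw [hz]

/-- A partial derivative of a periodic function has zero integral over a period. -/
lemma setIntegral_fderiv_eq_zero_of_periodic {p : ℕ} {E : Type*} [NormedAddCommGroup E]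
    [NormedSpace ℝ E] {T : Fin p → ℝ} (hT : ∀ i, 0 < T i) {f : (Fin p → ℝ) → E}
    (hf : ContDiff ℝ 1 f) (j : Fin p) (hper : ∀ t, f (t + Pi.single j (T j)) = f t) :
    ∫ t in Set.Icc 0 T, fderiv ℝ f t (Pi.single j 1) = 0 := by
  obtain _ | m := p
  · exact j.elim0
  have hdf : Continuous fun t => fderiv ℝ f t (Pi.single j 1) :=
    (hf.continuous_fderiv one_ne_zero).clm_apply continuous_const
  have hsum : ∀ t, ∑ i, (if i = j then fderiv ℝ f t else 0) (Pi.single i 1)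
      = fderiv ℝ f t (Pi.single j 1) := by
    intro t
    rw [Finset.sum_eq_single j (fun i _ hi => by simp [hi]) (by simp)]
    simp
  have h := integral_divergence_of_hasFDerivAt_off_countable' (0 : Fin (m + 1) → ℝ) T
    (fun i => (hT i).le) (fun i => if i = j then f else 0)
    (fun i t => if i = j then fderiv ℝ f t else 0) ∅ Set.countable_empty
    (fun i => by
      split_ifs
      · exact hf.continuous.continuousOn
      · exact continuousOn_const)
    (fun t _ i => by
      split_ifs
      · exact (hf.differentiable one_ne_zero t).hasFDerivAt
      · exact hasFDerivAt_const _ _)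
    (by
      simp only [hsum]
      exact hdf.continuousOn.integrableOn_compact isCompact_Icc)
  simp only [hsum] at h
  rw [h]
  refine Finset.sum_eq_zero fun i _ => ?_
  split_ifs with hi
  · subst hi
    rw [sub_eq_zero]
    congr 1 with y
    rw [← hper (i.insertNth ((0 : Fin (m + 1) → ℝ) i) y)]
    congr 1
    ext l
    refine Fin.succAboveCases i ?_ (fun l => ?_) l <;> simp
  · simp

lemma setIntegral_comp_mul_unit_cube {p : ℕ} {T : Fin p → ℝ} (hT : ∀ i, 0 < T i)
    (F : (Fin p → ℝ) → ℝ) :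
    ∫ t in Set.Icc 0 T, F t = (∏ i, T i) * ∫ s in Set.Icc (0 : Fin p → ℝ) 1, F (T * s) := by
  have himg : (fun s => T * s) '' Set.Icc (0 : Fin p → ℝ) 1 = Set.Icc 0 T := by
    ext t
    constructor
    · rintro ⟨s, hs, rfl⟩
      refine ⟨fun i => mul_nonneg (hT i).le (hs.1 i), fun i => ?_⟩
      exact mul_le_of_le_one_right (hT i).le (hs.2 i)
    · intro ht
      refine ⟨fun i => t i / T i, ⟨fun i => div_nonneg (ht.1 i) (hT i).le, fun i => ?_⟩, ?_⟩
      · exact (div_le_one (hT i)).2 (ht.2 i)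
      · ext i
        exact mul_div_cancel₀ _ (hT i).ne'
  let L : (Fin p → ℝ) →L[ℝ] (Fin p → ℝ) := (Matrix.toLin' (Matrix.diagonal T)).toContinuousLinearMap
  have hL : ∀ s, L s = T * s := fun s => by
    ext i; simp [L, Matrix.mulVec_diagonal]
  have hdet : L.det = ∏ i, T i := by
    simp [L, ContinuousLinearMap.det, Matrix.det_diagonal]
  have h := integral_image_eq_integral_abs_det_fderiv_smul volume
    (measurableSet_Icc (a := (0 : Fin p → ℝ)) (b := 1)) (f := fun s => T * s) (f' := fun _ => L)
    (fun s _ => by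
      have := L.hasFDerivAt (x := s)
      exact (this.congr_of_eventuallyEq
        (Filter.Eventually.of_forall fun s => (hL s).symm)).hasFDerivWithinAt)
    (fun a _ b _ hab => by
      ext i
      exact mul_left_cancel₀ (hT i).ne' (congrFun hab i)) F
  rw [himg] at h
  rw [h, hdet, abs_of_nonneg (Finset.prod_nonneg fun i _ => (hT i).le)]
  simp [integral_const_mul]

lemma latticeChar_add_single {p : ℕ} (k : Fin p → ℤ) (t : Fin p → ℝ) (j : Fin p) :
    latticeChar k (t + Pi.single j 1) = latticeChar k t := by
  simp only [latticeChar, Pi.add_apply, Complex.ofReal_add, mul_add, Finset.sum_add_distrib,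
    Complex.exp_add]
  have : ∑ i, (k i : ℂ) * ((Pi.single j (1 : ℝ) : Fin p → ℝ) i : ℂ) = k j := by
    rw [Finset.sum_eq_single j (fun i _ hi => by simp [hi]) (by simp)]
    simp
  rw [this, mul_comm _ (k j : ℂ), Complex.exp_int_mul_two_pi_mul_I, mul_one]

lemma hasFDerivAt_latticeChar {p : ℕ} (k : Fin p → ℤ) (t : Fin p → ℝ) :
    ∃ L : (Fin p → ℝ) →L[ℝ] ℂ, HasFDerivAt (latticeChar k) L t ∧
      ∀ j, L (Pi.single j 1) = 2 * π * Complex.I * k j * latticeChar k t := by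
  let A : (Fin p → ℝ) →L[ℝ] ℂ := (2 * π * Complex.I) •
    ∑ i, (k i : ℂ) • (Complex.ofRealCLM ∘L ContinuousLinearMap.proj (R := ℝ) i)
  have hA : ∀ s, A s = 2 * π * Complex.I * ∑ i, (k i : ℂ) * (s i : ℂ) := fun s => by
    simp [A]
  have h := (A.hasFDerivAt (x := t)).cexp
  refine ⟨_, h.congr_of_eventuallyEq (Filter.Eventually.of_forall fun s => ?_), fun j => ?_⟩
  · simp [latticeChar, hA]
  · have : ∑ i, (k i : ℂ) * ((Pi.single j (1 : ℝ) : Fin p → ℝ) i : ℂ) = k j := by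
      rw [Finset.sum_eq_single j (fun i _ hi => by simp [hi]) (by simp)]
      simp
    simp only [smul_apply, smul_eq_mul, hA, this, latticeChar]
    ring

lemma contDiff_latticeChar {p : ℕ} (k : Fin p → ℤ) : ContDiff ℝ 1 (latticeChar k) := by
  unfold latticeChar
  refine ContDiff.cexp (contDiff_const.mul (ContDiff.sum fun i _ => contDiff_const.mul ?_))
  exact Complex.ofRealCLM.contDiff.comp (contDiff_apply ℝ ℝ i)

/-- The Fourier coefficients of a partial derivative. -/
lemma setIntegral_latticeChar_mul_fderiv {p : ℕ} {g : (Fin p → ℝ) → ℂ} (hg : ContDiff ℝ 1 g)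
    (hper : ∀ (k : Fin p → ℤ) t, g (fun i => t i + k i) = g t) (k : Fin p → ℤ) (j : Fin p) :
    ∫ t in Set.Icc (0 : Fin p → ℝ) 1, latticeChar (-k) t * fderiv ℝ g t (Pi.single j 1)
      = 2 * π * Complex.I * k j * ∫ t in Set.Icc (0 : Fin p → ℝ) 1, latticeChar (-k) t * g t := by
  have hc := contDiff_latticeChar (-k)
  have h0 := setIntegral_fderiv_eq_zero_of_periodic (T := (1 : Fin p → ℝ)) (fun _ => one_pos)
    (hc.mul hg) j (fun t => by
      have h1 := hper (Pi.single j 1) t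
      have h2 : (fun i => t i + ((Pi.single j 1 : Fin p → ℤ) i : ℝ)) = t + Pi.single j 1 := by
        ext i
        by_cases h : i = j
        · subst h; simp
        · simp [h]
      rw [h2] at h1
      simp only [Pi.one_apply, latticeChar_add_single, h1])
  have hd : ∀ t, fderiv ℝ (fun s => latticeChar (-k) s * g s) t (Pi.single j 1)
      = latticeChar (-k) t * fderiv ℝ g t (Pi.single j 1)
        - 2 * π * Complex.I * k j * (latticeChar (-k) t * g t) := by
    intro t
    obtain ⟨L, hL, hLj⟩ := hasFDerivAt_latticeChar (-k) t
    have h1 : fderiv ℝ (fun s => latticeChar (-k) s * g s) t = _ :=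
      (hL.mul (hg.differentiable one_ne_zero t).hasFDerivAt).fderiv
    rw [h1]
    simp [hLj]
    ring
  have hi1 : IntegrableOn (fun t => latticeChar (-k) t * fderiv ℝ g t (Pi.single j 1))
      (Set.Icc (0 : Fin p → ℝ) 1) :=
    (hc.continuous.mul ((hg.continuous_fderiv one_ne_zero).clm_apply
      continuous_const)).continuousOn.integrableOn_compact isCompact_Icc
  have hi2 : IntegrableOn (fun t => latticeChar (-k) t * g t) (Set.Icc (0 : Fin p → ℝ) 1) :=
    (hc.continuous.mul hg.continuous).continuousOn.integrableOn_compact isCompact_Icc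
  simp only [hd] at h0
  rw [integral_sub hi1 (hi2.const_mul _), integral_const_mul, sub_eq_zero] at h0
  exact h0

lemma fderiv_comp_add_of_periodic {E F : Type*} [NormedAddCommGroup E] [NormedSpace ℝ E]
    [NormedAddCommGroup F] [NormedSpace ℝ F] {f : E → F} {c : E} (h : ∀ t, f (t + c) = f t) (t : E) :
    fderiv ℝ f (t + c) = fderiv ℝ f t := by
  rw [← fderiv_comp_add_right]
  simp only [h]

/-- **Poincaré–Wirtinger inequality** on the unit torus. -/
lemma setIntegral_sq_le_of_integer_periodic {p : ℕ} {g : (Fin p → ℝ) → ℝ} (hg : ContDiff ℝ 1 g)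
    (hper : ∀ (k : Fin p → ℤ) t, g (fun i => t i + k i) = g t)
    (hmean : ∫ t in Set.Icc (0 : Fin p → ℝ) 1, g t = 0) :
    ∫ t in Set.Icc (0 : Fin p → ℝ) 1, g t ^ 2
      ≤ (1 / (2 * π)) ^ 2 *
        ∑ j, ∫ t in Set.Icc (0 : Fin p → ℝ) 1, fderiv ℝ g t (Pi.single j 1) ^ 2 := by
  set G : (Fin p → ℝ) → ℂ := fun t => (g t : ℂ) with hG
  have hGd : ContDiff ℝ 1 G := Complex.ofRealCLM.contDiff.comp hg
  have hGper : ∀ (k : Fin p → ℤ) t, G (fun i => t i + k i) = G t := fun k t => by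
    simp only [hG, hper]
  have hdG : ∀ t v, fderiv ℝ G t v = (fderiv ℝ g t v : ℂ) := fun t v => by
    have := (Complex.ofRealCLM.hasFDerivAt (x := g t)).comp t
      (hg.differentiable one_ne_zero t).hasFDerivAt
    have h2 : fderiv ℝ G t = Complex.ofRealCLM ∘L fderiv ℝ g t := this.fderiv
    rw [h2]; simp
  have hS := hasSum_sq_norm_integral_latticeChar G hGd.continuous hGper
  have hSj := fun j : Fin p => hasSum_sq_norm_integral_latticeChar
    (fun t => fderiv ℝ G t (Pi.single j 1))
    ((hGd.continuous_fderiv one_ne_zero).clm_apply continuous_const)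
    (fun k t => by
      have := fderiv_comp_add_of_periodic (f := G) (c := fun i => (k i : ℝ)) (fun s => hGper k s) t
      exact congrArg (fun L => L (Pi.single j 1)) this)
  simp only [setIntegral_latticeChar_mul_fderiv hGd hGper] at hSj
  have hR := (hasSum_sum (s := Finset.univ) fun j _ => hSj j).mul_left ((1 / (2 * π)) ^ 2)
  have key := hasSum_le (fun k => ?_) hS hR
  · simp only [hdG, Complex.norm_real, norm_eq_abs, sq_abs] at key
    simpa only [hG, Complex.norm_real, norm_eq_abs, sq_abs] using key
  · simp only [norm_mul, mul_pow, ← Finset.sum_mul]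
    by_cases hk : k = 0
    · subst hk
      have : ∫ t in Set.Icc (0 : Fin p → ℝ) 1, latticeChar (-0) t * G t = 0 := by
        simp only [latticeChar, hG, neg_zero, Pi.zero_apply, Int.cast_zero, zero_mul,
          Finset.sum_const_zero, mul_zero, Complex.exp_zero, one_mul]
        rw [integral_complex_ofReal, hmean, Complex.ofReal_zero]
      rw [this]; simp
    · obtain ⟨j, hj⟩ := Function.ne_iff.1 hk
      have h1 : (1 : ℝ) ≤ (k j : ℝ) ^ 2 := by
        have : (1 : ℤ) ≤ k j ^ 2 := Order.one_le_iff_pos.2 (sq_pos_of_ne_zero hj)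
        exact_mod_cast this
      have h2 : (1 : ℝ) ≤ ∑ i, (k i : ℝ) ^ 2 :=
        h1.trans (Finset.single_le_sum (f := fun i => (k i : ℝ) ^ 2)
          (fun i _ => sq_nonneg _) (Finset.mem_univ j))
      have h3 : (1 / (2 * π)) ^ 2 * ∑ i, (‖(2 : ℂ)‖ ^ 2 * ‖(π : ℂ)‖ ^ 2 * ‖Complex.I‖ ^ 2 *
          ‖(k i : ℂ)‖ ^ 2) = ∑ i, (k i : ℝ) ^ 2 := by
        rw [Finset.mul_sum]
        refine Finset.sum_congr rfl fun i _ => ?_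
        simp
        field_simp
      rw [← mul_assoc, h3]
      exact le_mul_of_one_le_left (sq_nonneg _) h2

/-- **Poincaré–Wirtinger inequality** for multiple periodic functions. -/
lemma setIntegral_sq_le_of_periodic {p : ℕ} {T : Fin p → ℝ} (hT : ∀ i, 0 < T i) {M : ℝ}
    (hM : ∀ i, T i ≤ M) {f : (Fin p → ℝ) → ℝ} (hf : ContDiff ℝ 1 f)
    (hper : ∀ (k : Fin p → ℤ) t, f (fun i => t i + k i * T i) = f t)
    (hmean : ∫ t in Set.Icc 0 T, f t = 0) :
    ∫ t in Set.Icc 0 T, f t ^ 2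
      ≤ (M / (2 * π)) ^ 2 * ∑ j, ∫ t in Set.Icc 0 T, fderiv ℝ f t (Pi.single j 1) ^ 2 := by
  have hV : 0 < ∏ i, T i := Finset.prod_pos fun i _ => hT i
  simp only [setIntegral_comp_mul_unit_cube hT] at hmean ⊢
  have hm : ContDiff ℝ 1 fun s : Fin p → ℝ => T * s := contDiff_const.mul contDiff_id
  have h := setIntegral_sq_le_of_integer_periodic (g := fun s => f (T * s)) (hf.comp hm)
    (fun k t => by
      refine Eq.trans ?_ (hper k (T * t))
      congr 1
      ext i
      simp only [Pi.mul_apply]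
      ring) ((mul_eq_zero.1 hmean).resolve_left hV.ne')
  have hd : ∀ s j, fderiv ℝ (fun s => f (T * s)) s (Pi.single j 1)
      = T j * fderiv ℝ f (T * s) (Pi.single j 1) := by
    intro s j
    let L := ContinuousLinearMap.mul ℝ (Fin p → ℝ) T
    have h1 := (hf.differentiable one_ne_zero (T * s)).hasFDerivAt.comp s
      (L.hasFDerivAt (x := s))
    have h2 : fderiv ℝ (fun s => f (T * s)) s = fderiv ℝ f (T * s) ∘L L := h1.fderiv
    have h3 : L (Pi.single j 1) = T j • Pi.single j 1 := by
      ext i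
      by_cases hi : i = j
      · subst hi; simp [L]
      · simp [L, hi]
    rw [h2, ContinuousLinearMap.comp_apply, h3, map_smul, smul_eq_mul]
  simp only [hd, mul_pow, integral_const_mul] at h
  have h4 : ∑ j, T j ^ 2 * ∫ s in Set.Icc (0 : Fin p → ℝ) 1,
        fderiv ℝ f (T * s) (Pi.single j 1) ^ 2
      ≤ M ^ 2 * ∑ j, ∫ s in Set.Icc (0 : Fin p → ℝ) 1,
        fderiv ℝ f (T * s) (Pi.single j 1) ^ 2 := by
    rw [Finset.mul_sum]
    refine Finset.sum_le_sum fun j _ => ?_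
    refine mul_le_mul_of_nonneg_right (pow_le_pow_left₀ (hT j).le (hM j) 2) ?_
    exact integral_nonneg fun _ => sq_nonneg _
  rw [← Finset.mul_sum]
  calc _ ≤ (∏ i, T i) * ((1 / (2 * π)) ^ 2 * (M ^ 2 * ∑ j, ∫ s in Set.Icc (0 : Fin p → ℝ) 1,
        fderiv ℝ f (T * s) (Pi.single j 1) ^ 2)) := by
        refine mul_le_mul_of_nonneg_left (h.trans ?_) hV.le
        exact mul_le_mul_of_nonneg_left h4 (sq_nonneg _)
    _ = _ := by ring


lemma ConvexOn.add_fderiv_sub_le {E : Type*} [NormedAddCommGroup E] [NormedSpace ℝ E] {f : E → ℝ}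
    (hf : ConvexOn ℝ Set.univ f) {w : E} (hw : DifferentiableAt ℝ f w) (y : E) :
    f w + fderiv ℝ f w (y - w) ≤ f y := by
  have hconv : ConvexOn ℝ Set.univ (f ∘ AffineMap.lineMap (k := ℝ) w y) := by
    simpa using hf.comp_affineMap (AffineMap.lineMap (k := ℝ) w y)
  have hd : HasDerivAt (f ∘ AffineMap.lineMap (k := ℝ) w y) (fderiv ℝ f w (y - w)) 0 := by
    refine HasFDerivAt.comp_hasDerivAt (f := AffineMap.lineMap (k := ℝ) w y) (0 : ℝ) ?_
      AffineMap.hasDerivAt_lineMap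
    simpa using hw.hasFDerivAt
  have h := hconv.le_slope_of_hasDerivAt (Set.mem_univ 0) (Set.mem_univ 1) zero_lt_one hd
  simp only [slope_def_field, Function.comp_apply, AffineMap.lineMap_apply_one,
    AffineMap.lineMap_apply_zero, sub_zero, div_one] at h
  linarith

lemma continuousLinearMap_apply_eq_sum {p n : ℕ}
    (L : (Fin n → ℝ) × (Fin n → Fin p → ℝ) →L[ℝ] ℝ) (z : (Fin n → ℝ) × (Fin n → Fin p → ℝ)) :
    L z = (∑ i, z.1 i * L (Pi.single i 1, 0))
      + ∑ i, ∑ β, z.2 i β * L (0, Pi.single i (Pi.single β 1)) := by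
  have hz : z = (∑ i, z.1 i • ((Pi.single i 1, 0) : (Fin n → ℝ) × (Fin n → Fin p → ℝ)))
      + ∑ i, ∑ β, z.2 i β •
        ((0, Pi.single i (Pi.single β 1)) : (Fin n → ℝ) × (Fin n → Fin p → ℝ)) := by
    ext i β
    · simp [Prod.fst_sum, Finset.sum_apply, Pi.single_apply]
    · simp only [Prod.snd_add, Prod.snd_sum, Prod.smul_snd, smul_zero, Finset.sum_const_zero,
        zero_add, Finset.sum_apply, Pi.smul_apply, smul_eq_mul]
      rw [Finset.sum_eq_single i (fun j _ hj => by simp [hj.symm]) (by simp),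
        Finset.sum_eq_single β (fun j _ hj => by simp [hj.symm]) (by simp)]
      simp
  conv_lhs => rw [hz]
  simp only [map_add, map_sum, map_smul, smul_eq_mul]

/-- Fenchel-type inequality between the linear lower bound of a convex function and its gradient,
coming from a quadratic upper bound. -/
lemma euclNorm_le_of_convex_of_quadratic_growth {p n : ℕ}
    {h : (Fin n → ℝ) × (Fin n → Fin p → ℝ) → ℝ} (hC1 : ContDiff ℝ 1 h)
    (hconv : ConvexOn ℝ Set.univ h) {α β γ δ : ℝ} (hα : 0 < α)
    (hlow : ∀ w, δ * euclNorm w - β ≤ h w)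
    (hhigh : ∀ w, h w ≤ α / 2 * (euclNorm w) ^ 2 + γ)
    (w : (Fin n → ℝ) × (Fin n → Fin p → ℝ)) {a : Fin n → ℝ} {b : Fin n → Fin p → ℝ}
    (ha : ∀ i, fderiv ℝ h w (Pi.single i 1, 0) = a i)
    (hb : ∀ i κ, fderiv ℝ h w (0, Pi.single i (Pi.single κ 1)) = b i κ) :
    δ * euclNorm w ≤ β + γ + ((∑ i, w.1 i * a i) + ∑ i, ∑ κ, w.2 i κ * b i κ)
      - ((∑ i, a i ^ 2) + ∑ i, ∑ κ, b i κ ^ 2) / (2 * α) := by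
  have hsub := hconv.add_fderiv_sub_le (hC1.differentiable one_ne_zero w)
    (α⁻¹ • ((a, b) : (Fin n → ℝ) × (Fin n → Fin p → ℝ)))
  have hv : fderiv ℝ h w (a, b) = (∑ i, a i ^ 2) + ∑ i, ∑ κ, b i κ ^ 2 := by
    rw [continuousLinearMap_apply_eq_sum]
    simp only [ha, hb, sq]
  have hw : fderiv ℝ h w w = (∑ i, w.1 i * a i) + ∑ i, ∑ κ, w.2 i κ * b i κ := by
    rw [continuousLinearMap_apply_eq_sum]
    simp only [ha, hb]
  rw [map_sub, map_smul, hv, hw, smul_eq_mul] at hsub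
  have hy := hhigh (α⁻¹ • ((a, b) : (Fin n → ℝ) × (Fin n → Fin p → ℝ)))
  have hn : euclNorm (α⁻¹ • ((a, b) : (Fin n → ℝ) × (Fin n → Fin p → ℝ))) ^ 2
      = (α⁻¹) ^ 2 * ((∑ i, a i ^ 2) + ∑ i, ∑ κ, b i κ ^ 2) := by
    rw [euclNorm, Real.sq_sqrt (by positivity)]
    simp only [Prod.smul_mk, Pi.smul_apply, smul_eq_mul, mul_pow, ← Finset.mul_sum, mul_add]
  rw [hn] at hy
  have hl := hlow w
  set S := (∑ i, a i ^ 2) + ∑ i, ∑ κ, b i κ ^ 2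
  have e1 : α / 2 * ((α⁻¹) ^ 2 * S) = S / (2 * α) := by field_simp
  have e2 : α⁻¹ * S = S / (2 * α) + S / (2 * α) := by field_simp; ring
  linarith

lemma periodBox_eq_Icc {p : ℕ} (T : Fin p → ℝ) : periodBox T = Set.Icc 0 T :=
  Set.pi_univ_Icc 0 T

lemma MultiPeriodic.add_single {p : ℕ} {E : Type*} {T : Fin p → ℝ} {u : (Fin p → ℝ) → E}
    (hu : MultiPeriodic T u) (j : Fin p) (t : Fin p → ℝ) : u (t + Pi.single j (T j)) = u t := by
  rw [← hu (Pi.single j 1) t]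
  congr 1
  ext i
  by_cases h : i = j
  · subst h; simp
  · simp [h]

lemma continuous_euclNorm {p n : ℕ} : Continuous (euclNorm (p := p) (n := n)) := by
  unfold euclNorm
  fun_prop

/-- The energy density of a periodic pair `(f, g)` is dominated by a continuous function whose
integral over a period is nonpositive. -/
lemma exists_energy_le_setIntegral_nonpos {p : ℕ} {T : Fin p → ℝ} (hT : ∀ i, 0 < T i) {M : ℝ} (hM0 : 0 < M)
    (hM : ∀ i, T i ≤ M) {f : (Fin p → ℝ) → ℝ} (hf : ContDiff ℝ 1 f) (hfper : MultiPeriodic T f)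
    {g : Fin p → (Fin p → ℝ) → ℝ} (hg : ∀ κ, ContDiff ℝ 1 (g κ))
    (hgper : ∀ κ, MultiPeriodic T (g κ)) :
    ∃ R : (Fin p → ℝ) → ℝ, Continuous R ∧ ∫ t in Set.Icc 0 T, R t ≤ 0 ∧ ∀ t,
      (∑ κ, g κ t * fderiv ℝ f t (Pi.single κ 1)) - f t * ∑ κ, fderiv ℝ (g κ) t (Pi.single κ 1)
        - M / (2 * π) * ((∑ κ, fderiv ℝ (g κ) t (Pi.single κ 1)) ^ 2
          + ∑ κ, fderiv ℝ f t (Pi.single κ 1) ^ 2) ≤ R t := by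
  have hCpos : 0 < M / (2 * π) := by positivity
  set C := M / (2 * π) with hC
  have hV : 0 < ∏ i, T i := Finset.prod_pos fun i _ => hT i
  set m : ℝ := (∏ i, T i)⁻¹ * ∫ t in Set.Icc 0 T, f t with hm
  have hvol : volume.real (Set.Icc 0 T) = ∏ i, T i := by
    simp [Measure.real, Real.volume_Icc_pi, ENNReal.toReal_prod, fun i => (hT i).le]
  have int_of : ∀ {F : (Fin p → ℝ) → ℝ}, Continuous F → IntegrableOn F (Set.Icc 0 T) :=
    fun h => h.continuousOn.integrableOn_compact isCompact_Icc
  have hdf : ∀ κ, Continuous fun t => fderiv ℝ f t (Pi.single κ 1) := fun κ =>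
    (hf.continuous_fderiv one_ne_zero).clm_apply continuous_const
  have hfg : ∀ κ, ContDiff ℝ 1 fun t => (f t - 2 * m) * g κ t := fun κ =>
    (hf.sub contDiff_const).mul (hg κ)
  have hdfg : ∀ κ, Continuous fun t =>
      fderiv ℝ (fun s => (f s - 2 * m) * g κ s) t (Pi.single κ 1) := fun κ =>
    ((hfg κ).continuous_fderiv one_ne_zero).clm_apply continuous_const
  have hfgd : ∀ κ t, fderiv ℝ (fun s => (f s - 2 * m) * g κ s) t (Pi.single κ 1)
      = (f t - 2 * m) * fderiv ℝ (g κ) t (Pi.single κ 1)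
        + g κ t * fderiv ℝ f t (Pi.single κ 1) := by
    intro κ t
    have h1 := ((hf.differentiable one_ne_zero t).hasFDerivAt.sub_const (2 * m)).mul
      ((hg κ).differentiable one_ne_zero t).hasFDerivAt
    have h2 : fderiv ℝ (fun s => (f s - 2 * m) * g κ s) t = _ := h1.fderiv
    rw [h2]
    simp
  have hmean : ∫ t in Set.Icc 0 T, (f t - m) = 0 := by
    rw [integral_sub (int_of hf.continuous) (int_of continuous_const), setIntegral_const, hvol, hm,
      smul_eq_mul, mul_inv_cancel_left₀ hV.ne', sub_self]
  have hP := setIntegral_sq_le_of_periodic hT hM (hf.sub contDiff_const)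
    (fun k t => congrArg (· - m) (hfper k t)) hmean
  simp only [fderiv_sub_const] at hP
  refine ⟨fun t => (∑ κ, fderiv ℝ (fun s => (f s - 2 * m) * g κ s) t (Pi.single κ 1))
    + (C⁻¹ * (f t - m) ^ 2 - C * ∑ κ, fderiv ℝ f t (Pi.single κ 1) ^ 2), ?_, ?_, fun t => ?_⟩
  · have := hf.continuous
    fun_prop
  · have i1 := fun κ (_ : κ ∈ Finset.univ) => int_of (hdfg κ)
    have i2 : IntegrableOn (fun t => C⁻¹ * (f t - m) ^ 2) (Set.Icc 0 T) :=
      int_of (((hf.continuous.sub continuous_const).pow 2).const_mul _)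
    have i3 : ∀ κ ∈ Finset.univ,
        IntegrableOn (fun t => fderiv ℝ f t (Pi.single κ 1) ^ 2) (Set.Icc 0 T) :=
      fun κ _ => int_of ((hdf κ).pow 2)
    have i4 : IntegrableOn (fun t => C * ∑ κ, fderiv ℝ f t (Pi.single κ 1) ^ 2) (Set.Icc 0 T) :=
      (integrable_finsetSum _ i3).const_mul C
    have i5 : IntegrableOn (fun t => C⁻¹ * (f t - m) ^ 2
        - C * ∑ κ, fderiv ℝ f t (Pi.single κ 1) ^ 2) (Set.Icc 0 T) := i2.sub i4
    rw [integral_add (integrable_finsetSum _ i1) i5, integral_finsetSum _ i1,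
      integral_sub i2 i4, integral_const_mul, integral_const_mul, integral_finsetSum _ i3,
      Finset.sum_eq_zero fun κ _ => setIntegral_fderiv_eq_zero_of_periodic hT (hfg κ) κ fun t => by
        rw [hfper.add_single, (hgper κ).add_single], zero_add, sub_nonpos]
    rw [inv_mul_le_iff₀ hCpos, ← mul_assoc, ← sq]
    exact hP
  · have hsum : ∑ κ, fderiv ℝ (fun s => (f s - 2 * m) * g κ s) t (Pi.single κ 1)
        = (f t - 2 * m) * ∑ κ, fderiv ℝ (g κ) t (Pi.single κ 1)
          + ∑ κ, g κ t * fderiv ℝ f t (Pi.single κ 1) := by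
      simp only [hfgd, Finset.sum_add_distrib, Finset.mul_sum]
    simp only [hsum]
    generalize ∑ κ, fderiv ℝ (g κ) t (Pi.single κ 1) = D
    generalize ∑ κ, fderiv ℝ f t (Pi.single κ 1) ^ 2 = S
    have hsq : 0 ≤ C⁻¹ * (f t - m + C * D) ^ 2 := by positivity
    have he : C⁻¹ * (f t - m + C * D) ^ 2
        = C⁻¹ * (f t - m) ^ 2 + 2 * (f t - m) * D + C * D ^ 2 := by
      field_simp; ring
    nlinarith

/-- Theorem 4, inequality (5): under the convexity and growth assumptions
`δ|u| − β ≤ H(t,u) ≤ (α/2)|u|² + γ` with `0 < α < π/(√p · max_i Tⁱ)` and `δ > 0`,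
every `C¹` multiply periodic solution of the multi-time Hamilton system satisfies
`∫ |u(t)| dt ≤ π(β+γ) T¹⋯Tᵖ / (δ(π − α√p · max_i Tⁱ))`. -/
theorem hamilton_periodic_solution_norm_bound
    (p n : ℕ) (hp : 0 < p) (hn : 0 < n)
    (T : Fin p → ℝ) (hT : ∀ i, 0 < T i)
    (H : (Fin p → ℝ) → (Fin n → ℝ) × (Fin n → Fin p → ℝ) → ℝ)
    (hmeas : ∀ w, Measurable fun t => H t w)
    (hC1 : ∀ t ∈ periodBox T, ContDiff ℝ 1 (H t))
    (hconv : ∀ t ∈ periodBox T, ConvexOn ℝ Set.univ (H t))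
    (α β γ δ : ℝ)
    (hα : 0 < α) (hα' : α < π / (Real.sqrt p * maxPeriod hp T))
    (hβ : 0 ≤ β) (hγ : 0 ≤ γ) (hδ : 0 < δ)
    (hlow : ∀ t ∈ periodBox T, ∀ w : (Fin n → ℝ) × (Fin n → Fin p → ℝ),
      δ * euclNorm w - β ≤ H t w)
    (hhigh : ∀ t ∈ periodBox T, ∀ w : (Fin n → ℝ) × (Fin n → Fin p → ℝ),
      H t w ≤ α / 2 * (euclNorm w) ^ 2 + γ)
    (x : (Fin p → ℝ) → (Fin n → ℝ)) (q : (Fin p → ℝ) → (Fin n → Fin p → ℝ))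
    (hx : ContDiff ℝ 1 x) (hq : ContDiff ℝ 1 q)
    (hxper : MultiPeriodic T x) (hqper : MultiPeriodic T q)
    (hsol : IsHamiltonSolution T H x q) :
    (∫ t in periodBox T, euclNorm (x t, q t))
      ≤ π * (β + γ) * (∏ i, T i) / (δ * (π - α * Real.sqrt p * maxPeriod hp T)) := by
  rw [periodBox_eq_Icc]
  have hM : ∀ i, T i ≤ maxPeriod hp T := fun i => Finset.le_sup' T (Finset.mem_univ i)
  have hM0 : 0 < maxPeriod hp T := (hT ⟨0, hp⟩).trans_le (hM _)
  set M := maxPeriod hp T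
  have hsq1 : 1 ≤ Real.sqrt p := Real.one_le_sqrt.2 (by exact_mod_cast hp)
  have hαM : α * Real.sqrt p * M < π := by
    rw [lt_div_iff₀ (by positivity)] at hα'
    linarith
  have hCα : M / (2 * π) ≤ 1 / (2 * α) := by
    rw [div_le_div_iff₀ (by positivity) (by positivity)]
    have : α * M ≤ α * Real.sqrt p * M := by
      rw [mul_assoc]
      exact mul_le_mul_of_nonneg_left (le_mul_of_one_le_left hM0.le hsq1) hα.le
    linarith
  have hxd : ∀ t v i, fderiv ℝ (fun s => x s i) t v = fderiv ℝ x t v i := fun t v i => by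
    have := (hasFDerivAt_pi'.1 (hx.differentiable one_ne_zero t).hasFDerivAt i).fderiv
    rw [this]; rfl
  have hqi : ∀ i, ContDiff ℝ 1 fun s => q s i := fun i => contDiff_pi.1 hq i
  have hqd : ∀ t v i κ, fderiv ℝ (fun s => q s i κ) t v = fderiv ℝ q t v i κ := fun t v i κ => by
    have h1 := (hasFDerivAt_pi'.1 (hq.differentiable one_ne_zero t).hasFDerivAt i)
    have h2 := (hasFDerivAt_pi'.1 h1 κ).fderiv
    rw [h2]; rfl
  choose R hRc hRint hR using fun i => exists_energy_le_setIntegral_nonpos hT hM0 hM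
    (f := fun s => x s i) (contDiff_pi.1 hx i) (fun k t => congrFun (hxper k t) i)
    (g := fun κ s => q s i κ) (fun κ => contDiff_pi.1 (hqi i) κ)
    (fun κ k t => congrFun (congrFun (hqper k t) i) κ)
  simp only [hxd, hqd] at hR
  have hpt : ∀ t ∈ Set.Icc 0 T, δ * euclNorm (x t, q t) ≤ β + γ + ∑ i, R i t := by
    intro t ht
    have ht' : t ∈ periodBox T := by rwa [periodBox_eq_Icc]
    have h := euclNorm_le_of_convex_of_quadratic_growth (hC1 t ht') (hconv t ht') hα (hlow t ht')
      (hhigh t ht') (x t, q t) (a := fun i => -∑ κ, fderiv ℝ q t (Pi.single κ 1) i κ)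
      (b := fun i κ => fderiv ℝ x t (Pi.single κ 1) i)
      (fun i => by rw [(hsol t ht').1 i, neg_neg]) (fun i κ => ((hsol t ht').2 i κ).symm)
    have hsum := Finset.sum_le_sum fun i (_ : i ∈ Finset.univ) => hR i t
    simp only [Finset.sum_sub_distrib, ← Finset.mul_sum, Finset.sum_add_distrib] at hsum
    simp only [neg_sq, mul_neg, Finset.sum_neg_distrib] at h
    have hS : 0 ≤ (∑ i, (∑ κ, fderiv ℝ q t (Pi.single κ 1) i κ) ^ 2)
        + ∑ i, ∑ κ, fderiv ℝ x t (Pi.single κ 1) i ^ 2 := by positivity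
    have hmul := mul_le_mul_of_nonneg_right hCα hS
    rw [one_div_mul_eq_div] at hmul
    linarith
  have hcont : Continuous fun t => euclNorm (x t, q t) :=
    continuous_euclNorm.comp (hx.continuous.prodMk hq.continuous)
  have hRi := fun i (_ : i ∈ Finset.univ) =>
    ((hRc i).continuousOn (s := Set.Icc 0 T)).integrableOn_compact (μ := volume) isCompact_Icc
  have hci : IntegrableOn (fun _ : Fin p → ℝ => β + γ) (Set.Icc 0 T) :=
    continuousOn_const.integrableOn_compact isCompact_Icc
  have hint := setIntegral_mono_on
    ((hcont.continuousOn.integrableOn_compact isCompact_Icc).const_mul δ)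
    (hci.add (integrable_finsetSum _ hRi)) measurableSet_Icc hpt
  have hvol : volume.real (Set.Icc 0 T) = ∏ i, T i := by
    simp [Measure.real, Real.volume_Icc_pi, ENNReal.toReal_prod, fun i => (hT i).le]
  have hV : 0 ≤ ∏ i, T i := Finset.prod_nonneg fun i _ => (hT i).le
  simp only [Pi.add_apply] at hint
  rw [integral_const_mul, integral_add hci (integrable_finsetSum _ hRi),
    integral_finsetSum _ hRi, setIntegral_const, hvol, smul_eq_mul] at hint
  have hRs := Finset.sum_nonpos fun i (_ : i ∈ Finset.univ) => hRint i
  have hI : δ * ∫ t in Set.Icc 0 T, euclNorm (x t, q t) ≤ (β + γ) * ∏ i, T i := by linarith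
  have hden : 0 < π - α * Real.sqrt p * M := sub_pos.2 hαM
  rw [le_div_iff₀ (by positivity)]
  calc (∫ t in Set.Icc 0 T, euclNorm (x t, q t)) * (δ * (π - α * Real.sqrt p * M))
      = (δ * ∫ t in Set.Icc 0 T, euclNorm (x t, q t)) * (π - α * Real.sqrt p * M) := by ring
    _ ≤ ((β + γ) * ∏ i, T i) * π := by
        refine mul_le_mul hI (sub_le_self _ (by positivity)) hden.le (by positivity)
    _ = _ := by ring
end
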